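/- arXiv:2412.15794 — 5 statements merged into one kernel-verified Lean document; each statement's English description precedes it below -/
import Mathlib

section
/- There exists a compact metric space X that is homeomorphic to the 2-sphere S², has finite Hausdorff 2-measure, and has infinite Nagata dimension; that is, for no integer n ≥ 0 does there exist a constant c > 0 such that the Nagata dimension of X is at most n with constant c. -/
open Set MeasureTheory Metric Filter
open scoped NNReal ENNReal

noncomputable section

/-- Nagata dimension of `X` is at most `n` with constant `c`: for every `s > 0` there is
a covering of `X` by sets of diameter at most `c·s` such that every set of diameter
less than `s` meets at most `n+1` members of the covering. -/
def NagataDimLE (X : Type*) [MetricSpace X] (n : ℕ) (c : ℝ) : Prop :=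
  ∀ s : ℝ, 0 < s → ∃ 𝒰 : Set (Set X),
    (⋃₀ 𝒰 = Set.univ) ∧
    (∀ U ∈ 𝒰, EMetric.diam U ≤ ENNReal.ofReal (c * s)) ∧
    (∀ A : Set X, EMetric.diam A < ENNReal.ofReal s →
      ({U ∈ 𝒰 | (A ∩ U).Nonempty}).Finite ∧
      ({U ∈ 𝒰 | (A ∩ U).Nonempty}).ncard ≤ n + 1)

open scoped symmDiff

/-- The Hamming distance on the discrete cube of subsets of `α`. -/
def cubeDist {α : Type*} [DecidableEq α] (u v : Finset α) : ℕ := (u ∆ v).card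

section Cube

variable {α : Type*} [DecidableEq α]

lemma cubeDist_self (u : Finset α) : cubeDist u u = 0 := by simp [cubeDist]

lemma cubeDist_comm (u v : Finset α) : cubeDist u v = cubeDist v u := by
  simp [cubeDist, symmDiff_comm]

lemma cubeDist_triangle (u v w : Finset α) :
    cubeDist u w ≤ cubeDist u v + cubeDist v w :=
  (Finset.card_le_card (symmDiff_triangle u v w)).trans (Finset.card_union_le _ _)

lemma cubeDist_le_card [Fintype α] (u v : Finset α) : cubeDist u v ≤ Fintype.card α :=
  Finset.card_le_univ _

lemma one_le_cubeDist {u v : Finset α} (h : u ≠ v) : 1 ≤ cubeDist u v :=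
  Finset.card_pos.2 (Finset.nonempty_iff_ne_empty.2 fun h' => h (symmDiff_eq_bot.1 h'))

lemma cubeDist_symmDiff_singleton (u : Finset α) (i : α) : cubeDist u (u ∆ {i}) = 1 := by
  simp [cubeDist]

/-- If the discrete cube is coloured with colour classes of diameter at most `C`, and the cube has
large dimension, then some ball of radius one contains many colours. -/
lemma exists_ball_many_colours [Fintype α] {ι : Type*} [DecidableEq ι] (C n : ℕ)
    (hN : C + n * (C + 1) < Fintype.card α) (col : Finset α → ι)
    (hcol : ∀ u v, col u = col v → cubeDist u v ≤ C) :
    ∃ u, n < ((Finset.univ.filter fun v => cubeDist u v ≤ 1).image col).card := by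
  by_contra! hsmall
  let base : ι → Finset α := Function.invFun col
  have hbase : ∀ u, cubeDist u (base (col u)) ≤ C := fun u =>
    hcol _ _ (Function.invFun_eq ⟨u, rfl⟩).symm
  let r : Finset α → Finset α → Prop := fun x y => ∃ i, i ∉ x ∆ base (col x) ∧ y = x ∆ {i}
  classical
  have key := Finset.card_mul_le_card_mul (s := Finset.univ) (t := Finset.univ) r
    (m := Fintype.card α - C) (n := n * (C + 1)) ?_ ?_
  · have : 0 < (Finset.univ : Finset (Finset α)).card := Finset.card_pos.2 ⟨∅, Finset.mem_univ _⟩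
    have := Nat.le_of_mul_le_mul_left key this
    omega
  · intro x _
    have h1 : ((x ∆ base (col x))ᶜ.image fun i => x ∆ {i}) ⊆
        Finset.univ.bipartiteAbove r x := by
      intro y hy
      obtain ⟨i, hi, rfl⟩ := Finset.mem_image.1 hy
      simp only [Finset.mem_bipartiteAbove, Finset.mem_univ, true_and]
      exact ⟨i, Finset.mem_compl.1 hi, rfl⟩
    refine le_trans ?_ (Finset.card_le_card h1)
    rw [Finset.card_image_of_injective, Finset.card_compl]
    · exact Nat.sub_le_sub_left (hbase x) _
    · intro i j h
      exact Finset.singleton_injective (symmDiff_right_injective x h)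
  · intro y _
    have h1 : Finset.univ.bipartiteBelow r y ⊆
        ((Finset.univ.filter fun v => cubeDist y v ≤ 1).image col).biUnion
          fun a => (y ∆ base a).image fun i => y ∆ {i} := by
      intro x hx
      simp only [Finset.mem_bipartiteBelow, Finset.mem_univ, true_and] at hx
      obtain ⟨i, hi, rfl⟩ := hx
      refine Finset.mem_biUnion.2 ⟨col x, Finset.mem_image_of_mem _ ?_,
        Finset.mem_image.2 ⟨i, ?_, ?_⟩⟩
      · simp [cubeDist_comm _ x, cubeDist_symmDiff_singleton]
      · have : x ∆ {i} ∆ base (col x) = (x ∆ base (col x)) ∆ {i} := by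
          rw [symmDiff_right_comm]
        rw [this, Finset.mem_symmDiff]
        exact Or.inr ⟨Finset.mem_singleton_self i, hi⟩
      · simp
    refine (Finset.card_le_card h1).trans ((Finset.card_biUnion_le_card_mul _ _ (C + 1) ?_).trans
      (Nat.mul_le_mul_right _ (hsmall y)))
    intro a ha
    obtain ⟨x, hx, rfl⟩ := Finset.mem_image.1 ha
    have h2 := cubeDist_triangle y x (base (col x))
    have h3 := hbase x
    have h4 : cubeDist y x ≤ 1 := by simpa using hx
    exact Finset.card_image_le.trans (show cubeDist y (base (col x)) ≤ C + 1 by omega)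

end Cube

/-- A metric space containing scaled copies of all discrete cubes has infinite Nagata dimension. -/
lemma not_nagataDimLE_of_cubes {X : Type*} [MetricSpace X]
    (h : ∀ N : ℕ, ∃ ε : ℝ, 0 < ε ∧ ∃ P : Finset (Fin N) → X,
      ∀ u v, dist (P u) (P v) = ε * cubeDist u v) (n : ℕ) (c : ℝ) (hc : 0 < c) :
    ¬ NagataDimLE X n c := by
  classical
  intro hX
  obtain ⟨C, hC⟩ := exists_nat_ge (c * 3)
  obtain ⟨ε, hε, P, hP⟩ := h (C + (n + 1) * (C + 1) + 1)
  obtain ⟨𝒰, hcov, hdiam, hmult⟩ := hX (3 * ε) (by positivity)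
  have hex : ∀ u, ∃ U ∈ 𝒰, P u ∈ U := fun u => by
    simpa using (hcov ▸ mem_univ (P u) : P u ∈ ⋃₀ 𝒰)
  choose col hcolU hcolP using hex
  obtain ⟨u, hu⟩ := exists_ball_many_colours C (n + 1) (by simp) col (by
    intro u v huv
    have h1 : edist (P u) (P v) ≤ ENNReal.ofReal (c * (3 * ε)) :=
      (Metric.edist_le_ediam_of_mem (hcolP u) (huv ▸ hcolP v)).trans (hdiam _ (hcolU u))
    rw [edist_dist, ENNReal.ofReal_le_ofReal_iff (by positivity), hP] at h1
    have h2 : (cubeDist u v : ℝ) ≤ C := by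
      refine le_trans ?_ hC
      refine le_of_mul_le_mul_left ?_ hε
      linarith
    exact_mod_cast h2)
  let A : Set X := P '' {v | cubeDist u v ≤ 1}
  have hA : ediam A < ENNReal.ofReal (3 * ε) := by
    refine lt_of_le_of_lt (b := ENNReal.ofReal (2 * ε)) ?_
      ((ENNReal.ofReal_lt_ofReal_iff (by positivity)).2 (by linarith))
    refine Metric.ediam_le ?_
    rintro _ ⟨v, hv, rfl⟩ _ ⟨w, hw, rfl⟩
    rw [edist_dist]
    refine ENNReal.ofReal_le_ofReal ?_
    rw [hP]
    have h1 := cubeDist_triangle v u w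
    rw [cubeDist_comm v u] at h1
    have h2 : (cubeDist v w : ℝ) ≤ 2 := by
      have : cubeDist v w ≤ 2 := h1.trans (Nat.add_le_add hv hw)
      exact_mod_cast this
    nlinarith
  obtain ⟨hfin, hcard⟩ := hmult A hA
  have hsub : (((Finset.univ.filter fun v => cubeDist u v ≤ 1).image col : Finset (Set X)) :
      Set (Set X)) ⊆ {U ∈ 𝒰 | (A ∩ U).Nonempty} := by
    intro U hU
    obtain ⟨v, hv, rfl⟩ := Finset.mem_image.1 (Finset.mem_coe.1 hU)
    exact ⟨hcolU v, P v, ⟨v, by simpa using hv, rfl⟩, hcolP v⟩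
  have := Set.ncard_le_ncard hsub hfin
  rw [Set.ncard_coe_finset] at this
  omega

/-- The scale of the `N`-dimensional cube. -/
def cubeScale (N : ℕ) : ℝ := (1 / 16) ^ N / (2 * (N + 1))

lemma cubeScale_pos (N : ℕ) : 0 < cubeScale N := by unfold cubeScale; positivity

lemma cubeScale_mul_le (N : ℕ) : cubeScale N * N ≤ (1 / 16) ^ N / 2 := by
  unfold cubeScale
  rw [div_mul_eq_mul_div, div_le_div_iff₀ (by positivity) (by positivity)]
  have : (0 : ℝ) < (1 / 16) ^ N := by positivity
  nlinarith

/-- The parameter in `[0, 2]` of the vertex `u` of the `N`-dimensional cube. -/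
def cubeParam (N : ℕ) (u : Finset (Fin N)) : ℝ :=
  (1 / 8) ^ N + (Fintype.equivFin (Finset (Fin N)) u : ℕ) * (1 / 16) ^ N

lemma le_cubeParam (N : ℕ) (u : Finset (Fin N)) : (1 / 8) ^ N ≤ cubeParam N u := by
  unfold cubeParam
  have : (0 : ℝ) ≤ (Fintype.equivFin (Finset (Fin N)) u : ℕ) * (1 / 16) ^ N := by positivity
  linarith

lemma cubeParam_le (N : ℕ) (u : Finset (Fin N)) : cubeParam N u ≤ 2 * (1 / 8) ^ N := by
  unfold cubeParam
  have h1 : ((Fintype.equivFin (Finset (Fin N)) u : ℕ) : ℝ) ≤ 2 ^ N := by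
    have h := (Fintype.equivFin (Finset (Fin N)) u).isLt.le.trans_eq
      (Fintype.card_finset.trans (congrArg _ (Fintype.card_fin N)))
    exact_mod_cast h
  have h2 : (2 : ℝ) ^ N * (1 / 16) ^ N = (1 / 8) ^ N := by
    rw [← mul_pow]; norm_num
  have := mul_le_mul_of_nonneg_right h1 (show (0 : ℝ) ≤ (1 / 16) ^ N by positivity)
  linarith

lemma one_sixteenth_pow_le (N : ℕ) : ((1 / 16) ^ N : ℝ) ≤ (1 / 8) ^ N :=
  pow_le_pow_left₀ (by norm_num) (by norm_num) N

lemma cubeParam_mem (N : ℕ) (u : Finset (Fin N)) : cubeParam N u ∈ Icc (0 : ℝ) 2 := by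
  have h1 := le_cubeParam N u
  have h2 := cubeParam_le N u
  have h3 : (0 : ℝ) ≤ (1 / 8) ^ N := by positivity
  have h4 : ((1 / 8) ^ N : ℝ) ≤ 1 := pow_le_one₀ (by norm_num) (by norm_num)
  constructor <;> linarith

lemma cubeParam_separated {N : ℕ} {u v : Finset (Fin N)} (h : u ≠ v) :
    cubeScale N * N ≤ |cubeParam N u - cubeParam N v| := by
  refine (cubeScale_mul_le N).trans ?_
  have h0 : (0 : ℝ) < (1 / 16) ^ N := by positivity
  have h1 : ((Fintype.equivFin (Finset (Fin N)) u : ℕ) : ℤ) -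
      (Fintype.equivFin (Finset (Fin N)) v : ℕ) ≠ 0 := by
    rw [sub_ne_zero]
    intro h'
    exact h ((Fintype.equivFin _).injective (Fin.ext (by exact_mod_cast h')))
  have h2 := Int.one_le_abs h1
  have h3 : (1 : ℝ) ≤ |((Fintype.equivFin (Finset (Fin N)) u : ℕ) : ℝ) -
      (Fintype.equivFin (Finset (Fin N)) v : ℕ)| := by exact_mod_cast h2
  have h4 : cubeParam N u - cubeParam N v = (((Fintype.equivFin (Finset (Fin N)) u : ℕ) : ℝ) -
      (Fintype.equivFin (Finset (Fin N)) v : ℕ)) * (1 / 16) ^ N := by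
    unfold cubeParam; ring
  rw [h4, abs_mul, abs_of_pos h0]
  nlinarith

lemma cubeParam_separated_of_ne {N M : ℕ} (h : M ≠ N) (u : Finset (Fin N)) (v : Finset (Fin M)) :
    cubeScale N * N ≤ |cubeParam M v - cubeParam N u| := by
  refine (cubeScale_mul_le N).trans ?_
  have h0 := one_sixteenth_pow_le N
  have h0' : (0 : ℝ) < (1 / 8) ^ N := by positivity
  have h1 := le_cubeParam N u
  have h2 := cubeParam_le N u
  have h3 := le_cubeParam M v
  have h4 := cubeParam_le M v
  have step : ∀ a b : ℕ, a < b → ((1 / 8) ^ b : ℝ) ≤ (1 / 8) ^ a / 8 := fun a b hab => by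
    have : ((1 / 8) ^ b : ℝ) ≤ (1 / 8) ^ (a + 1) :=
      pow_le_pow_of_le_one (by norm_num) (by norm_num) hab
    rw [pow_succ] at this
    linarith
  rcases lt_or_gt_of_ne h with h | h
  · have := step _ _ h
    exact le_trans (by linarith) (le_abs_self _)
  · have := step _ _ h
    exact le_trans (by linarith) (neg_le_abs _)

/-- The real functions on `[0, 2]` that are `1`-Lipschitz for the Euclidean metric and also
`1`-Lipschitz for the scaled Hamming metric on the vertices of each cube. -/
structure CubeLipschitz where
  /-- The underlying function. -/
  toFun : ℝ → ℝ
  map_zero : toFun 0 = 0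
  lipschitz : ∀ x ∈ Icc (0 : ℝ) 2, ∀ y ∈ Icc (0 : ℝ) 2, |toFun x - toFun y| ≤ |x - y|
  cube : ∀ N u v, |toFun (cubeParam N u) - toFun (cubeParam N v)| ≤ cubeScale N * cubeDist u v

instance : TopologicalSpace CubeLipschitz := ⊥

instance : DiscreteTopology CubeLipschitz := ⟨rfl⟩

/-- A strictly increasing function that varies little on each cube. -/
def CubeLipschitz.sq : CubeLipschitz where
  toFun x := x ^ 2 / 8
  map_zero := by norm_num
  lipschitz x hx y hy := by
    have h1 : x ^ 2 / 8 - y ^ 2 / 8 = (x - y) * ((x + y) / 8) := by ring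
    rw [h1, abs_mul]
    refine mul_le_of_le_one_right (abs_nonneg _) ?_
    rw [abs_le]
    constructor <;> linarith [hx.1, hx.2, hy.1, hy.2]
  cube N u v := by
    rcases eq_or_ne u v with rfl | h
    · simp [cubeDist_self]
    have hd : (1 : ℝ) ≤ cubeDist u v := by exact_mod_cast one_le_cubeDist h
    refine le_trans ?_ (le_mul_of_one_le_right (cubeScale_pos N).le hd)
    have hsq : ∀ w, cubeParam N w ^ 2 / 8 ≤ (1 / 8) ^ N * (1 / 8) ^ N / 2 := fun w => by
      have h1 := le_cubeParam N w
      have h2 := cubeParam_le N w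
      have h3 : (0 : ℝ) < (1 / 8) ^ N := by positivity
      nlinarith
    have hnn : ∀ w, 0 ≤ cubeParam N w ^ 2 / 8 := fun w => by positivity
    have hbound : ((1 / 8) ^ N * (1 / 8) ^ N / 2 : ℝ) ≤ cubeScale N := by
      unfold cubeScale
      rw [div_le_div_iff₀ (by norm_num) (by positivity)]
      have h4 : ((N : ℝ) + 1) ≤ 4 ^ N := by
        have : N < 4 ^ N := Nat.lt_pow_self (by norm_num)
        exact_mod_cast this
      have h5 : ((1 / 8) ^ N * (1 / 8) ^ N : ℝ) * 4 ^ N = (1 / 16) ^ N := by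
        rw [← mul_pow, ← mul_pow]; norm_num
      have h6 : (0 : ℝ) < (1 / 8) ^ N * (1 / 8) ^ N := by positivity
      nlinarith
    rw [abs_le]
    constructor <;> linarith [hsq u, hsq v, hnn u, hnn v]

/-- The upper envelope of tents centred at the vertices of the `N`-dimensional cube, whose value at a vertex
decreases with the Hamming distance to `w`. -/
def cubeTent (N : ℕ) (w : Finset (Fin N)) (x : ℝ) : ℝ :=
  Finset.univ.sup' Finset.univ_nonempty fun u : Finset (Fin N) =>
    max 0 (cubeScale N * (N - cubeDist u w) - |x - cubeParam N u|)

lemma cubeTent_sub_le (N : ℕ) (w : Finset (Fin N)) (x y : ℝ) :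
    cubeTent N w x - cubeTent N w y ≤ |x - y| := by
  rw [sub_le_iff_le_add]
  refine Finset.sup'_le _ _ fun u _ => ?_
  have h1 : max 0 (cubeScale N * (N - cubeDist u w) - |y - cubeParam N u|) ≤ cubeTent N w y :=
    Finset.le_sup' (fun u : Finset (Fin N) =>
      max 0 (cubeScale N * (N - cubeDist u w) - |y - cubeParam N u|)) (Finset.mem_univ u)
  have h2 := abs_sub_le y x (cubeParam N u)
  rw [abs_sub_comm y x] at h2
  have h3 := max_le_iff.1 h1
  exact max_le (by linarith [abs_nonneg (x - y), h3.1]) (by linarith [h3.2])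

lemma cubeTent_eq_zero {N : ℕ} {w : Finset (Fin N)} {x : ℝ}
    (hx : ∀ u, cubeScale N * N ≤ |x - cubeParam N u|) : cubeTent N w x = 0 := by
  refine le_antisymm (Finset.sup'_le _ _ fun u _ => max_le le_rfl ?_) ?_
  · have : 0 ≤ cubeScale N * cubeDist u w := mul_nonneg (cubeScale_pos N).le (Nat.cast_nonneg _)
    linarith [hx u]
  · exact (le_max_left _ _).trans (Finset.le_sup' (fun u : Finset (Fin N) =>
      max 0 (cubeScale N * (N - cubeDist u w) - |x - cubeParam N u|)) (Finset.mem_univ w))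

lemma cubeTent_cubeParam (N : ℕ) (w v : Finset (Fin N)) :
    cubeTent N w (cubeParam N v) = cubeScale N * (N - cubeDist v w) := by
  have hle : ∀ u, (0 : ℝ) ≤ cubeScale N * (N - cubeDist u w) := fun u => by
    refine mul_nonneg (cubeScale_pos N).le (sub_nonneg.2 ?_)
    have := cubeDist_le_card u w
    rw [Fintype.card_fin] at this
    exact_mod_cast this
  refine le_antisymm (Finset.sup'_le _ _ fun u _ => max_le (hle v) ?_) ?_
  · rcases eq_or_ne v u with rfl | h
    · simp
    · have h1 := cubeParam_separated h
      have : 0 ≤ cubeScale N * cubeDist u w := mul_nonneg (cubeScale_pos N).le (Nat.cast_nonneg _)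
      linarith [hle v]
  · refine le_trans ?_ (Finset.le_sup' (fun u : Finset (Fin N) =>
      max 0 (cubeScale N * (N - cubeDist u w) - |cubeParam N v - cubeParam N u|))
      (Finset.mem_univ v))
    simp

/-- The function `cubeTent N w` as a member of `CubeLipschitz`. -/
def CubeLipschitz.tent (N : ℕ) (w : Finset (Fin N)) : CubeLipschitz where
  toFun := cubeTent N w
  map_zero := cubeTent_eq_zero fun u => by
    have h1 := le_cubeParam N u
    have h2 := cubeScale_mul_le N
    have h3 := one_sixteenth_pow_le N
    have h4 : (0 : ℝ) < (1 / 8) ^ N := by positivity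
    rw [zero_sub, abs_neg]
    exact le_trans (by linarith) (le_abs_self _)
  lipschitz x _ y _ := by
    have h1 := cubeTent_sub_le N w x y
    have h2 := cubeTent_sub_le N w y x
    rw [abs_sub_comm y x] at h2
    exact abs_le.2 ⟨by linarith, h1⟩
  cube M u v := by
    rcases eq_or_ne M N with rfl | h
    · rw [cubeTent_cubeParam, cubeTent_cubeParam, ← mul_sub, abs_mul,
        abs_of_pos (cubeScale_pos M)]
      refine mul_le_mul_of_nonneg_left ?_ (cubeScale_pos M).le
      have h1 : (cubeDist u w : ℝ) ≤ cubeDist u v + cubeDist v w := by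
        exact_mod_cast cubeDist_triangle u v w
      have h2 : (cubeDist v w : ℝ) ≤ cubeDist u v + cubeDist u w := by
        rw [cubeDist_comm u v]
        exact_mod_cast cubeDist_triangle v u w
      rw [abs_le]
      constructor <;> linarith
    · rw [cubeTent_eq_zero fun a => cubeParam_separated_of_ne h a u,
        cubeTent_eq_zero fun a => cubeParam_separated_of_ne h a v, sub_self, abs_zero]
      exact mul_nonneg (cubeScale_pos M).le (Nat.cast_nonneg _)

/-- The boundary of the cube `[-1, 1]³`, with the metric of the maximum norm. -/
abbrev CubeBoundary : Type := sphere (0 : Fin 3 → ℝ) 1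

lemma CubeBoundary.add_one_mem (q : CubeBoundary) : q.1 0 + 1 ∈ Icc (0 : ℝ) 2 := by
  have h1 : ‖q.1 0‖ ≤ 1 := (norm_le_pi_norm q.1 0).trans (by simp)
  have h2 := abs_le.1 (by simpa using h1 : |q.1 0| ≤ 1)
  constructor <;> linarith [h2.1, h2.2]

/-- The arc `[0, 2]` embedded among the bounded functions on `CubeLipschitz`, composed with the
first coordinate of the cube. -/
def cubeArc (q : CubeBoundary) : BoundedContinuousFunction CubeLipschitz ℝ :=
  BoundedContinuousFunction.ofNormedAddCommGroupDiscrete (fun f => f.toFun (q.1 0 + 1)) 2 (by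
    intro f
    have hq := q.add_one_mem
    have h1 := f.lipschitz _ hq 0 (by simp)
    rw [f.map_zero, sub_zero, sub_zero, abs_of_nonneg hq.1] at h1
    exact h1.trans hq.2)

/-- The embedding of the boundary of the cube which replaces the first coordinate by the arc. -/
def cubeEmbedding (q : CubeBoundary) : BoundedContinuousFunction CubeLipschitz ℝ × ℝ × ℝ :=
  (cubeArc q, q.1 1, q.1 2)

lemma cubeEmbedding_lipschitz : LipschitzWith 1 cubeEmbedding := by
  have hcoord : ∀ i (p q : CubeBoundary), dist (p.1 i) (q.1 i) ≤ dist p q := fun i p q =>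
    dist_le_pi_dist p.1 q.1 i
  refine LipschitzWith.of_dist_le_mul fun p q => ?_
  rw [NNReal.coe_one, one_mul]
  refine max_le ?_ (max_le (hcoord 1 p q) (hcoord 2 p q))
  refine (BoundedContinuousFunction.dist_le dist_nonneg).2 fun f => ?_
  refine le_trans (f.lipschitz _ p.add_one_mem _ q.add_one_mem) ?_
  rw [add_sub_add_right_eq_sub]
  exact hcoord 0 p q

lemma cubeEmbedding_injective : Function.Injective cubeEmbedding := by
  intro p q h
  simp only [cubeEmbedding, Prod.mk.injEq] at h
  have h0 : (p.1 0 + 1) ^ 2 / 8 = (q.1 0 + 1) ^ 2 / 8 := DFunLike.congr_fun h.1 CubeLipschitz.sq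
  have h1 : p.1 0 + 1 = q.1 0 + 1 :=
    (pow_left_inj₀ p.add_one_mem.1 q.add_one_mem.1 two_ne_zero).1 (by linarith)
  ext i
  fin_cases i
  · exact add_right_cancel h1
  · exact h.2.1
  · exact h.2.2

/-- The vertices of the discrete cubes, on the boundary of the cube `[-1, 1]³`. -/
def cubeVertex (N : ℕ) (u : Finset (Fin N)) : CubeBoundary :=
  ⟨![cubeParam N u - 1, 1, 0], by
    have h := cubeParam_mem N u
    rw [mem_sphere_zero_iff_norm]
    refine le_antisymm ((pi_norm_le_iff_of_nonneg zero_le_one).2 fun i => ?_) ?_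
    · fin_cases i
      · exact abs_le.2 ⟨by simp; linarith [h.1], by simp; linarith [h.2]⟩
      · simp
      · simp
    · simpa using norm_le_pi_norm ![cubeParam N u - 1, 1, 0] 1⟩

lemma dist_cubeEmbedding_cubeVertex (N : ℕ) (u v : Finset (Fin N)) :
    dist (cubeEmbedding (cubeVertex N u)) (cubeEmbedding (cubeVertex N v)) =
      cubeScale N * cubeDist u v := by
  have hnn : 0 ≤ cubeScale N * cubeDist u v := mul_nonneg (cubeScale_pos N).le (Nat.cast_nonneg _)
  have harc : ∀ w f, cubeArc (cubeVertex N w) f = f.toFun (cubeParam N w) := fun w f => by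
    simp [cubeArc, cubeVertex]
  refine le_antisymm (max_le ((BoundedContinuousFunction.dist_le hnn).2 fun f => ?_) ?_) ?_
  · simp only [cubeEmbedding]
    rw [harc, harc]
    exact f.cube N u v
  · simpa [cubeEmbedding, cubeVertex] using hnn
  · refine le_trans ?_ (le_max_left _ _)
    refine le_trans ?_ (BoundedContinuousFunction.dist_coe_le_dist (CubeLipschitz.tent N u))
    simp only [cubeEmbedding]
    rw [harc, harc, Real.dist_eq]
    refine le_trans (le_of_eq ?_) (le_abs_self _)
    simp only [CubeLipschitz.tent, cubeTent_cubeParam, cubeDist_self, cubeDist_comm v u]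
    push_cast
    ring

/-- Unit spheres of linearly homeomorphic normed spaces are homeomorphic. -/
def sphereHomeomorph {E F : Type*} [NormedAddCommGroup E] [NormedSpace ℝ E]
    [NormedAddCommGroup F] [NormedSpace ℝ F] (e : E ≃L[ℝ] F) :
    sphere (0 : E) 1 ≃ₜ sphere (0 : F) 1 where
  toFun x := ⟨‖e x‖⁻¹ • e x, by
    have : e x ≠ 0 := by simpa using ne_zero_of_mem_unit_sphere x
    simp [norm_smul, this]⟩
  invFun y := ⟨‖e.symm y‖⁻¹ • e.symm y, by
    have : e.symm y ≠ 0 := by simpa using ne_zero_of_mem_unit_sphere y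
    simp [norm_smul, this]⟩
  left_inv x := by
    have : e x ≠ 0 := by simpa using ne_zero_of_mem_unit_sphere x
    ext1
    simp [norm_smul, smul_smul, this]
  right_inv y := by
    have : e.symm y ≠ 0 := by simpa using ne_zero_of_mem_unit_sphere y
    ext1
    simp [norm_smul, smul_smul, this]
  continuous_toFun := by
    refine Continuous.subtype_mk (Continuous.smul (Continuous.inv₀ (by fun_prop) fun x => ?_)
      (by fun_prop)) _
    simpa using ne_zero_of_mem_unit_sphere x
  continuous_invFun := by
    refine Continuous.subtype_mk (Continuous.smul (Continuous.inv₀ (by fun_prop) fun x => ?_)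
      (by fun_prop)) _
    simpa using ne_zero_of_mem_unit_sphere x

lemma hausdorffMeasure_cubeBoundary_lt_top :
    μH[(2 : ℝ)] (sphere (0 : Fin 3 → ℝ) 1) < ⊤ := by
  let face : Fin 3 → ℝ → Set (Fin 3 → ℝ) := fun i a =>
    (fun y : Fin 2 → ℝ => i.insertNth (α := fun _ => ℝ) a y) '' Icc (-1) 1
  have hface : ∀ i a, μH[(2 : ℝ)] (face i a) < ⊤ := fun i a => by
    have hl : LipschitzWith 1 (fun y : Fin 2 → ℝ => i.insertNth (α := fun _ => ℝ) a y) := by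
      refine LipschitzWith.of_dist_le_mul fun y z => ?_
      rw [NNReal.coe_one, one_mul, dist_pi_le_iff dist_nonneg]
      intro j
      rcases Fin.eq_self_or_eq_succAbove i j with rfl | ⟨k, rfl⟩
      · simp
      · simpa using dist_le_pi_dist y z k
    refine (hl.hausdorffMeasure_image_le zero_le_two _).trans_lt ?_
    have h2 : μH[(2 : ℝ)] = (volume : Measure (Fin 2 → ℝ)) := by
      simpa using hausdorffMeasure_pi_real (ι := Fin 2)
    rw [h2]
    simpa using (isCompact_Icc (a := (-1 : Fin 2 → ℝ)) (b := 1)).measure_lt_top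
  have hcover : sphere (0 : Fin 3 → ℝ) 1 ⊆ ⋃ i, (face i 1 ∪ face i (-1)) := by
    intro q hq
    rw [mem_sphere_zero_iff_norm] at hq
    have hle : ∀ j, |q j| ≤ 1 := fun j => hq ▸ norm_le_pi_norm q j
    obtain ⟨i, hi⟩ : ∃ i, 1 ≤ |q i| := by
      by_contra! h
      exact ((pi_norm_lt_iff one_pos).2 h).ne hq
    have hmem : ∀ a, q i = a → q ∈ face i a := fun a ha =>
      ⟨i.removeNth q, ⟨fun j => (abs_le.1 (hle _)).1, fun j => (abs_le.1 (hle _)).2⟩, by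
        simp [← ha]⟩
    refine mem_iUnion.2 ⟨i, ?_⟩
    exact (eq_or_eq_neg_of_abs_eq (le_antisymm (hle i) hi)).imp (hmem 1) (hmem (-1))
  refine (measure_mono hcover).trans_lt ?_
  refine (measure_iUnion_fintype_le _ _).trans_lt (ENNReal.sum_lt_top.2 fun i _ => ?_)
  exact (measure_union_le _ _).trans_lt (ENNReal.add_lt_top.2 ⟨hface _ _, hface _ _⟩)

lemma hausdorffMeasure_range_lt_top [MeasurableSpace (range cubeEmbedding)]
    [BorelSpace (range cubeEmbedding)] :
    μH[(2 : ℝ)] (univ : Set (range cubeEmbedding)) < ⊤ := by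
  have hl : LipschitzWith 1 (rangeFactorization cubeEmbedding) := cubeEmbedding_lipschitz
  have hr : (univ : Set (range cubeEmbedding)) = rangeFactorization cubeEmbedding '' univ := by
    rw [image_univ, rangeFactorization_surjective.range_eq]
  rw [hr]
  refine (hl.hausdorffMeasure_image_le zero_le_two _).trans_lt ?_
  rw [← (isometry_subtype_coe (s := sphere (0 : Fin 3 → ℝ) 1)).hausdorffMeasure_image
    (Or.inl zero_le_two), image_univ, Subtype.range_coe]
  simpa using hausdorffMeasure_cubeBoundary_lt_top

/-- There is a compact metric space homeomorphic to the `2`-sphere `S²`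
(the unit sphere of Euclidean `3`-space), with finite Hausdorff `2`-measure, whose
Nagata dimension is infinite: no `n` works with any constant `c > 0`. -/
theorem stmt5 :
    ∃ (X : Type) (mX : MetricSpace X),
      (by
        letI := mX
        letI : MeasurableSpace X := borel X
        haveI : BorelSpace X := ⟨rfl⟩
        exact CompactSpace X ∧
          Nonempty (X ≃ₜ Metric.sphere (0 : EuclideanSpace ℝ (Fin 3)) 1) ∧
          μH[(2 : ℝ)] (Set.univ : Set X) < ⊤ ∧
          ∀ (n : ℕ) (c : ℝ), 0 < c → ¬ NagataDimLE X n c : Prop) := by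
  refine ⟨range cubeEmbedding, inferInstance, ?_⟩
  let : MeasurableSpace (range cubeEmbedding) := borel _
  have : BorelSpace (range cubeEmbedding) := ⟨rfl⟩
  refine ⟨isCompact_iff_compactSpace.1 (isCompact_range cubeEmbedding_lipschitz.continuous),
    ⟨?_⟩, hausdorffMeasure_range_lt_top, not_nagataDimLE_of_cubes fun N =>
      ⟨cubeScale N, cubeScale_pos N, fun u => ⟨_, mem_range_self (cubeVertex N u)⟩,
        dist_cubeEmbedding_cubeVertex N⟩⟩
  have hcont : Continuous (Equiv.ofInjective _ cubeEmbedding_injective) :=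
    cubeEmbedding_lipschitz.continuous.subtype_mk _
  exact (hcont.homeoOfEquivCompactToT2.symm).trans
    (sphereHomeomorph (EuclideanSpace.equiv (Fin 3) ℝ).symm)
end
end

section
/- Let I be a finite set and let S, S' ⊆ I be subsets, each with at least two elements, satisfying S ∩ S' ≠ ∅. In the Euclidean space ℝ^I with standard basis (e_i), let Δ = convexHull{e_i : i ∈ S} and Δ' = convexHull{e_i : i ∈ S'}, and set n = min(|S|, |S'|) − 1. Then for all x ∈ Δ and y ∈ Δ' there exists z ∈ Δ ∩ Δ' = convexHull{e_i : i ∈ S ∩ S'} such that ‖x − z‖ + ‖z − y‖ ≤ 4√n · ‖x − y‖, where ‖·‖ denotes the Euclidean norm. -/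
open Set

noncomputable section

/-- A point lies in the standard simplex on `S` iff its coordinates are nonnegative, vanish
outside `S` and sum to one. -/
theorem mem_convexHull_single_iff {I : Type*} [Fintype I] [DecidableEq I] (S : Finset I)
    (x : EuclideanSpace ℝ I) :
    x ∈ convexHull ℝ ((fun i => EuclideanSpace.single i (1 : ℝ)) '' (S : Set I)) ↔
      (∀ i, 0 ≤ x i) ∧ (∀ i, i ∉ S → x i = 0) ∧ ∑ i, x i = 1 := by
  constructor
  · intro hx
    have hconv : Convex ℝ {x : EuclideanSpace ℝ I |
        (∀ i, 0 ≤ x i) ∧ (∀ i, i ∉ S → x i = 0) ∧ ∑ i, x i = 1} := by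
      rintro u ⟨hu0, huS, hu1⟩ v ⟨hv0, hvS, hv1⟩ a b ha hb hab
      refine ⟨fun i => ?_, fun i hi => ?_, ?_⟩
      · simpa using add_nonneg (mul_nonneg ha (hu0 i)) (mul_nonneg hb (hv0 i))
      · simp [huS i hi, hvS i hi]
      · simp [Finset.sum_add_distrib, ← Finset.mul_sum, hu1, hv1, hab]
    refine convexHull_min ?_ hconv hx
    rintro _ ⟨j, hj, rfl⟩
    refine ⟨fun i => ?_, fun i hi => ?_, ?_⟩
    · simp only [PiLp.single_apply]
      split_ifs <;> norm_num
    · have hij : i ≠ j := fun h => hi (h ▸ hj)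
      simp [hij]
    · simp [PiLp.single_apply]
  · rintro ⟨h0, hS, h1⟩
    have hsum : ∑ i ∈ S, x i = 1 := by
      rw [← h1]
      exact Finset.sum_subset (Finset.subset_univ S) fun i _ hi => hS i hi
    have hx : x = ∑ i ∈ S, x i • EuclideanSpace.single i (1 : ℝ) := by
      ext k
      by_cases hk : k ∈ S
      · simp [Pi.single_apply, hk]
      · simp [Pi.single_apply, hk, hS k hk]
    rw [hx]
    exact (convex_convexHull ℝ _).sum_mem (fun i _ => h0 i) hsum
      fun i hi => subset_convexHull ℝ _ ⟨i, hi, rfl⟩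

/-- Moving the mass of `x` outside `S'` to a common vertex gives a connecting point in the common
face, at distance controlled by the number of vertices of the simplex containing `x`. -/
theorem exists_mem_convexHull_single_inter_dist_le {I : Type*} [Fintype I] [DecidableEq I]
    (S S' : Finset I) (hSS' : (S ∩ S').Nonempty) (n : ℕ) (hn : 1 ≤ n) (hcard : S.card ≤ n + 1)
    (x y : EuclideanSpace ℝ I)
    (hx : x ∈ convexHull ℝ ((fun i => EuclideanSpace.single i (1 : ℝ)) '' (S : Set I)))
    (hy : y ∈ convexHull ℝ ((fun i => EuclideanSpace.single i (1 : ℝ)) '' (S' : Set I))) :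
    ∃ z ∈ convexHull ℝ
        ((fun i => EuclideanSpace.single i (1 : ℝ)) '' ((S ∩ S' : Finset I) : Set I)),
      dist x z + dist z y ≤ 4 * Real.sqrt n * dist x y := by
  obtain ⟨hx0, hxS, hx1⟩ := (mem_convexHull_single_iff S x).1 hx
  obtain ⟨-, hyS, -⟩ := (mem_convexHull_single_iff S' y).1 hy
  obtain ⟨j, hj⟩ := hSS'
  have hjS' : j ∈ S' := (Finset.mem_inter.1 hj).2
  let w : I → ℝ := fun i => if i ∈ S' then 0 else x i
  have hw0 : ∀ i, 0 ≤ w i := fun i => by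
    by_cases hi : i ∈ S' <;> simp [w, hi, hx0 i]
  have hwx : ∀ i, w i ≤ x i := fun i => by
    by_cases hi : i ∈ S' <;> simp [w, hi, hx0 i]
  let a : ℝ := ∑ i, w i
  have ha0 : 0 ≤ a := Finset.sum_nonneg fun i _ => hw0 i
  let z : EuclideanSpace ℝ I := WithLp.toLp 2 fun i => x i - w i + if i = j then a else 0
  have hz : ∀ i, z i = x i - w i + if i = j then a else 0 := fun i => rfl
  have hdist : ∀ u v : EuclideanSpace ℝ I, dist u v ^ 2 = ∑ i, (u i - v i) ^ 2 := by
    intro u v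
    rw [EuclideanSpace.dist_eq, Real.sq_sqrt (Finset.sum_nonneg fun i _ => sq_nonneg _)]
    simp [Real.dist_eq, sq_abs]
  have hwsq : ∑ i, w i ^ 2 ≤ dist x y ^ 2 := by
    rw [hdist]
    refine Finset.sum_le_sum fun i _ => ?_
    by_cases hi : i ∈ S'
    · simpa [w, hi] using sq_nonneg (x i - y i)
    · simp [w, hi, hyS i hi]
  have hmass : a ^ 2 ≤ n * ∑ i, w i ^ 2 := by
    have hsupp : ∀ i, i ∉ S \ S' → w i = 0 := by
      intro i hi
      by_cases hi' : i ∈ S'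
      · simp [w, hi']
      · have : i ∉ S := fun h => hi (Finset.mem_sdiff.2 ⟨h, hi'⟩)
        simp [w, hxS i this]
    have hsum : a = ∑ i ∈ S \ S', w i :=
      (Finset.sum_subset (Finset.subset_univ _) fun i _ hi => hsupp i hi).symm
    have hsumsq : ∑ i, w i ^ 2 = ∑ i ∈ S \ S', w i ^ 2 :=
      (Finset.sum_subset (Finset.subset_univ _) fun i _ hi => by simp [hsupp i hi]).symm
    have hle : (S \ S').card ≤ n := by
      have h1 := Finset.card_sdiff_add_card_inter S S'
      have h2 : 0 < (S ∩ S').card := Finset.card_pos.2 ⟨j, hj⟩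
      omega
    rw [hsum, hsumsq]
    refine sq_sum_le_card_mul_sum_sq.trans ?_
    have : 0 ≤ ∑ i ∈ S \ S', w i ^ 2 := Finset.sum_nonneg fun i _ => sq_nonneg _
    gcongr
  have hxz : dist x z ^ 2 = ∑ i, w i ^ 2 + a ^ 2 := by
    have hterm : ∀ i, (x i - z i) ^ 2 = w i ^ 2 + if i = j then a ^ 2 else 0 := by
      intro i
      rw [hz]
      by_cases hi : i = j
      · subst hi
        simp [w, hjS']
      · simp [hi]
    rw [hdist, Finset.sum_congr rfl fun i _ => hterm i]
    simp [Finset.sum_add_distrib]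
  refine ⟨z, (mem_convexHull_single_iff _ z).2 ⟨fun i => ?_, fun i hi => ?_, ?_⟩, ?_⟩
  · rw [hz]
    have := hwx i
    split_ifs <;> linarith
  · have hij : i ≠ j := fun h => hi (h ▸ hj)
    rw [hz]
    by_cases hi' : i ∈ S'
    · have : i ∉ S := fun h => hi (Finset.mem_inter.2 ⟨h, hi'⟩)
      simp [w, hi', hij, hxS i this]
    · simp [w, hi', hij]
  · simp only [hz]
    simp [Finset.sum_add_distrib, hx1, a]
  · have hn1 : (1 : ℝ) ≤ n := by exact_mod_cast hn
    have hs1 : 1 ≤ Real.sqrt n := Real.one_le_sqrt.2 hn1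
    have hs2 : Real.sqrt n ^ 2 = n := Real.sq_sqrt (by linarith)
    have hd : 0 ≤ dist x y := dist_nonneg
    have hbound : dist x z ≤ 3 / 2 * Real.sqrt n * dist x y := by
      refine (sq_le_sq₀ dist_nonneg (by positivity)).1 ?_
      calc dist x z ^ 2 = ∑ i, w i ^ 2 + a ^ 2 := hxz
        _ ≤ (1 + n) * ∑ i, w i ^ 2 := by linarith
        _ ≤ (1 + n) * dist x y ^ 2 := by gcongr
        _ ≤ (9 / 4 * n) * dist x y ^ 2 := by gcongr; linarith
        _ = (3 / 2 * Real.sqrt n * dist x y) ^ 2 := by rw [mul_pow, mul_pow, hs2]; ring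
    have htri : dist z y ≤ dist x z + dist x y := by
      simpa [dist_comm z x] using dist_triangle z x y
    nlinarith [mul_le_mul_of_nonneg_right hs1 hd]

/-- (Almost-optimal connecting points in intersecting standard simplices.)
Let `S, S' ⊆ I` have at least two elements each and `S ∩ S' ≠ ∅`. With `Δ`, `Δ'` the
standard simplices on `S`, `S'` in Euclidean `ℝ^I` and `n = min(|S|, |S'|) − 1`, we have
`Δ ∩ Δ' = convexHull {e_i : i ∈ S ∩ S'}`, and for all `x ∈ Δ`, `y ∈ Δ'` there exists
`z ∈ Δ ∩ Δ'` with `‖x − z‖ + ‖z − y‖ ≤ 4√n · ‖x − y‖`. -/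
theorem stmt6 {I : Type*} [Fintype I] [DecidableEq I] (S S' : Finset I)
    (hS : 2 ≤ S.card) (hS' : 2 ≤ S'.card) (hSS' : (S ∩ S').Nonempty)
    (n : ℕ) (hn : n = min S.card S'.card - 1)
    (x y : EuclideanSpace ℝ I)
    (hx : x ∈ convexHull ℝ ((fun i => EuclideanSpace.single i (1 : ℝ)) '' (S : Set I)))
    (hy : y ∈ convexHull ℝ ((fun i => EuclideanSpace.single i (1 : ℝ)) '' (S' : Set I))) :
    convexHull ℝ ((fun i => EuclideanSpace.single i (1 : ℝ)) '' (S : Set I)) ∩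
        convexHull ℝ ((fun i => EuclideanSpace.single i (1 : ℝ)) '' (S' : Set I)) =
      convexHull ℝ ((fun i => EuclideanSpace.single i (1 : ℝ)) '' ((S ∩ S' : Finset I) : Set I)) ∧
    ∃ z ∈ convexHull ℝ
        ((fun i => EuclideanSpace.single i (1 : ℝ)) '' ((S ∩ S' : Finset I) : Set I)),
      dist x z + dist z y ≤ 4 * Real.sqrt n * dist x y := by
  have hn1 : 1 ≤ n := by omega
  constructor
  · ext u
    simp only [mem_inter_iff, mem_convexHull_single_iff]
    constructor
    · rintro ⟨⟨h0, hu, h1⟩, -, hu', -⟩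
      refine ⟨h0, fun i hi => ?_, h1⟩
      by_cases hiS : i ∈ S
      · exact hu' i fun h => hi (Finset.mem_inter.2 ⟨hiS, h⟩)
      · exact hu i hiS
    · rintro ⟨h0, hu, h1⟩
      exact ⟨⟨h0, fun i hi => hu i fun h => hi (Finset.mem_inter.1 h).1, h1⟩,
        h0, fun i hi => hu i fun h => hi (Finset.mem_inter.1 h).2, h1⟩
  · rcases le_total S.card S'.card with h | h
    · exact exists_mem_convexHull_single_inter_dist_le S S' hSS' n hn1 (by omega) x y hx hy
    · rw [Finset.inter_comm] at hSS' ⊢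
      obtain ⟨z, hz, hle⟩ :=
        exists_mem_convexHull_single_inter_dist_le S' S hSS' n hn1 (by omega) y x hy hx
      refine ⟨z, hz, ?_⟩
      rw [dist_comm x z, dist_comm z y, dist_comm x y, add_comm]
      exact hle
end
end

section
/- Let f : X → Y be a continuous map from a compact metric space X to a separable metric space Y that is an absolute Lipschitz neighborhood retract. Then for every ε > 0 there exists a Lipschitz map g : X → Y with sup_{x ∈ X} d(f(x), g(x)) < ε. -/
open Set Metric
open scoped NNReal

noncomputable section

universe u

/-- `Y` is an absolute Lipschitz neighborhood retract: there is `C ≥ 1` such that whenever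
`Y` is isometrically embedded in a metric space `Z`, there are an open neighborhood `U` of
the image and a `C`-Lipschitz retraction of `U` onto the image. -/
def IsALNR (Y : Type u) [MetricSpace Y] : Prop :=
  ∃ C : ℝ≥0, 1 ≤ C ∧
    ∀ (Z : Type u) [MetricSpace Z] (ι : Y → Z), Isometry ι →
      ∃ (U : Set Z) (r : Z → Z),
        IsOpen U ∧ Set.range ι ⊆ U ∧ LipschitzOnWith C r U ∧
        (∀ z ∈ U, r z ∈ Set.range ι) ∧ (∀ y : Y, r (ι y) = ι y)

/-- Every pseudometric space has an `r`-separated `r`-net. -/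
theorem exists_isSeparated_net {X : Type*} [PseudoMetricSpace X] {r : ℝ} (hr : 0 ≤ r) :
    ∃ N : Set X, (∀ x ∈ N, ∀ y ∈ N, x ≠ y → r < dist x y) ∧ ∀ x, ∃ y ∈ N, dist x y ≤ r := by
  lift r to ℝ≥0 using hr
  obtain ⟨N, hN⟩ := zorn_subset {N : Set X | N ⊆ univ ∧ IsSeparated r N} fun c hc hchain =>
    ⟨⋃₀ c, ⟨subset_univ _, (pairwise_sUnion hchain.directedOn).2 fun s hs => (hc hs).2⟩,
      fun s hs => subset_sUnion_of_mem hs⟩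
  refine ⟨N, fun x hx y hy hxy => ?_, fun x => ?_⟩
  · have h : (r : ENNReal) < edist x y := hN.prop.2 hx hy hxy
    rw [edist_nndist] at h
    exact_mod_cast h
  · obtain ⟨y, hy, h⟩ := IsCover.of_maximal_isSeparated hN (mem_univ x)
    refine ⟨y, hy, ?_⟩
    have h' : edist x y ≤ r := h
    rw [edist_nndist] at h'
    exact_mod_cast h'

/-- A bounded uniformly continuous map into `ℓ^∞(ι, ℝ)` is a uniform limit of Lipschitz maps. -/
theorem UniformContinuous.exists_lipschitzWith_dist_lt {X ι : Type*} [PseudoMetricSpace X]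
    {F : X → lp (fun _ : ι => ℝ) ⊤} (hF : UniformContinuous F)
    (hb : Bornology.IsBounded (range F)) {ε : ℝ} (hε : 0 < ε) :
    ∃ (g : X → lp (fun _ : ι => ℝ) ⊤) (K : ℝ≥0), LipschitzWith K g ∧
      ∀ x, dist (F x) (g x) < ε := by
  obtain ⟨M, hM0, hM⟩ : ∃ M : ℝ, 0 < M ∧ ∀ x y, dist (F x) (F y) ≤ M := by
    obtain ⟨M, hM⟩ := isBounded_iff.1 hb
    exact ⟨max M 1, by positivity, fun x y =>
      (hM (mem_range_self x) (mem_range_self y)).trans (le_max_left _ _)⟩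
  obtain ⟨δ, hδ, hδε⟩ : ∃ δ : ℝ, 0 < δ ∧ 4 * δ < ε := ⟨ε / 5, by positivity, by linarith⟩
  obtain ⟨η, hη, hFη⟩ := uniformContinuous_iff.1 hF δ hδ
  obtain ⟨L, hL, hFL⟩ : ∃ L : ℝ≥0, 0 < L ∧ ∀ x y, dist (F x) (F y) ≤ δ + L * dist x y := by
    refine ⟨⟨M / η, by positivity⟩, NNReal.coe_pos.1 (by exact div_pos hM0 hη), fun x y => ?_⟩
    change _ ≤ δ + M / η * dist x y
    rcases lt_or_ge (dist x y) η with h | h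
    · have := hFη h
      have : 0 ≤ M / η * dist x y := by positivity
      linarith
    · calc dist (F x) (F y) ≤ M / η * η := by rw [div_mul_cancel₀ _ hη.ne']; exact hM x y
        _ ≤ M / η * dist x y := by gcongr
        _ ≤ δ + M / η * dist x y := by linarith
  have hL' : (0 : ℝ) < L := hL
  have hLδ : L * (δ / L) = δ := mul_div_cancel₀ _ hL'.ne'
  obtain ⟨N, hN, hNc⟩ := exists_isSeparated_net (X := X) (r := δ / L) (by positivity)
  have hlip : LipschitzOnWith (2 * L) F N := LipschitzOnWith.of_dist_le_mul fun x hx y hy => by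
    rcases eq_or_ne x y with rfl | hxy
    · simp
    · have h1 := hFL x y
      have h2 : L * (δ / L) ≤ L * dist x y := by
        have := (hN x hx y hy hxy).le
        gcongr
      push_cast
      linarith
  obtain ⟨g, hg, hgF⟩ := hlip.extend_lp_infty
  refine ⟨g, 2 * L, hg, fun x => ?_⟩
  obtain ⟨y, hy, hxy⟩ := hNc x
  have h1 := hFL x y
  have h2 : dist (g y) (g x) ≤ 2 * L * dist x y := by
    simpa [dist_comm] using hg.dist_le_mul y x
  have h3 : L * dist x y ≤ L * (δ / L) := by gcongr
  have h4 := dist_triangle (F x) (F y) (g x)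
  rw [← hgF hy] at h2
  linarith

/-- (Lipschitz approximation of continuous maps.)
A continuous map from a compact metric space to a separable metric space that is an
absolute Lipschitz neighborhood retract can be uniformly approximated by Lipschitz maps. -/
theorem stmt7 {X : Type*} {Y : Type u} [MetricSpace X] [CompactSpace X] [MetricSpace Y]
    [TopologicalSpace.SeparableSpace Y] (hY : IsALNR Y)
    (f : X → Y) (hf : Continuous f) (ε : ℝ) (hε : 0 < ε) :
    ∃ (g : X → Y) (L : ℝ≥0), LipschitzWith L g ∧ ∀ x : X, dist (f x) (g x) < ε := by
  obtain ⟨C, hC, hC'⟩ := hY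
  have hι : Isometry (fun y => ULift.up.{u} (kuratowskiEmbedding Y y)) :=
    kuratowskiEmbedding.isometry Y
  obtain ⟨U, r, hU, hιU, hr, hrU, hrι⟩ := hC' _ _ hι
  have hk : Continuous (fun x => kuratowskiEmbedding Y (f x)) :=
    (kuratowskiEmbedding.isometry Y).continuous.comp hf
  obtain ⟨δ, hδ, hδU⟩ := (isCompact_range (hι.continuous.comp hf)).exists_thickening_subset_open hU
    ((range_comp_subset_range f _).trans hιU)
  have hC0 : (0 : ℝ) < C := lt_of_lt_of_le one_pos hC
  obtain ⟨h, K, hh, hhd⟩ :=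
    (CompactSpace.uniformContinuous_of_continuous hk).exists_lipschitzWith_dist_lt
      (isCompact_range hk).isBounded (lt_min hδ (div_pos hε hC0))
  have hmem : ∀ x, ULift.up.{u} (h x) ∈ U := fun x =>
    hδU (mem_thickening_iff.2 ⟨_, mem_range_self x, by
      rw [dist_comm]; exact (hhd x).trans_le (min_le_left _ _)⟩)
  choose g hg using fun x => hrU _ (hmem x)
  beta_reduce at hg
  refine ⟨g, C * K, LipschitzWith.of_dist_le_mul fun x y => ?_, fun x => ?_⟩
  · rw [← hι.dist_eq, hg, hg, NNReal.coe_mul, mul_assoc]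
    refine (hr.dist_le_mul _ (hmem x) _ (hmem y)).trans ?_
    gcongr
    exact hh.dist_le_mul x y
  · rw [← hι.dist_eq, hg, ← hrι (f x)]
    refine (hr.dist_le_mul _ (hιU (mem_range_self _)) _ (hmem x)).trans_lt ?_
    rw [← lt_div_iff₀' hC0]
    exact (hhd x).trans_le (min_le_right _ _)
end
end

section
/- Let n ≥ 1, let X be a metric space with finite Hausdorff n-measure, and let U ⊆ X be an open set with X \ U nonempty. Then for Lebesgue-almost every δ > 0 the level set {x ∈ X : dist(x, X \ U) = δ} has finite Hausdorff (n−1)-measure. -/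
open Set MeasureTheory Metric
open scoped NNReal ENNReal

noncomputable section

open Filter Topology in
/-- A qualitative Eilenberg inequality: almost every slice of a set of finite `(d + 1)`-dimensional
Hausdorff measure by a real-valued Lipschitz function has finite `d`-dimensional Hausdorff
measure. -/
theorem LipschitzWith.ae_hausdorffMeasure_inter_preimage_singleton_lt_top {X : Type*}
    [EMetricSpace X] [MeasurableSpace X] [BorelSpace X] {K : ℝ≥0} {f : X → ℝ}
    (hf : LipschitzWith K f) {d : ℝ} (hd : 0 ≤ d) {s : Set X} (hs : μH[d + 1] s < ⊤) :
    ∀ᵐ y ∂(volume : Measure ℝ), μH[d] (s ∩ f ⁻¹' {y}) < ⊤ := by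
  have cover (k : ℕ) : ∃ t : ℕ → Set X, s ⊆ ⋃ i, t i ∧ (∀ i, ediam (t i) ≤ (k : ℝ≥0∞)⁻¹) ∧
      ∑' i, ⨆ _ : (t i).Nonempty, ediam (t i) ^ (d + 1) ≤ μH[d + 1] s + 1 := by
    have h : μH[d + 1] s < μH[d + 1] s + 1 := ENNReal.lt_add_right hs.ne one_ne_zero
    nth_rw 1 [Measure.hausdorffMeasure_apply] at h
    have h' := (le_iSup₂ (f := fun (r : ℝ≥0∞) (_ : 0 < r) ↦
      ⨅ (t : ℕ → Set X) (_ : s ⊆ ⋃ n, t n) (_ : ∀ n, ediam (t n) ≤ r),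
        ∑' n, ⨆ _ : (t n).Nonempty, ediam (t n) ^ (d + 1)) (k : ℝ≥0∞)⁻¹ (by simp)).trans_lt h
    simp only [iInf_lt_iff] at h'
    obtain ⟨t, hst, ht, hlt⟩ := h'
    exact ⟨t, hst, ht, hlt.le⟩
  choose t hst ht hsum using cover
  let c (k i : ℕ) : Set ℝ := closure (f '' t k i)
  let g (k : ℕ) (y : ℝ) : ℝ≥0∞ := ∑' i, (c k i).indicator (fun _ ↦ ediam (t k i) ^ d) y
  have hc (k i : ℕ) : MeasurableSet (c k i) := isClosed_closure.measurableSet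
  have hg (k : ℕ) : Measurable (g k) :=
    Measurable.tsum fun i ↦ measurable_const.indicator (hc k i)
  have slice_integral_le (k i : ℕ) :
      ∫⁻ y, (c k i).indicator (fun _ ↦ ediam (t k i) ^ d) y ≤
        K * ⨆ _ : (t k i).Nonempty, ediam (t k i) ^ (d + 1) := by
    rw [lintegral_indicator_const (hc k i)]
    rcases (t k i).eq_empty_or_nonempty with h | h
    · simp [c, h]
    · have hvol : volume (c k i) ≤ K * ediam (t k i) :=
        (Real.volume_le_diam _).trans (by
          rw [Metric.ediam_closure]
          exact hf.ediam_image_le _)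
      rw [iSup_pos h, ENNReal.rpow_add_of_nonneg _ _ hd zero_le_one, ENNReal.rpow_one]
      grw [hvol]
      exact (mul_left_comm _ _ _).le
  have integral_le (k : ℕ) : ∫⁻ y, g k y ≤ K * (μH[d + 1] s + 1) := by
    rw [lintegral_tsum fun i ↦ (measurable_const.indicator (hc k i)).aemeasurable]
    grw [ENNReal.tsum_le_tsum (slice_integral_le k), ENNReal.tsum_mul_left, hsum k]
  have integral_liminf_lt_top : ∫⁻ y, liminf (fun k ↦ g k y) atTop < ⊤ :=
    calc ∫⁻ y, liminf (fun k ↦ g k y) atTop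
        ≤ liminf (fun k ↦ ∫⁻ y, g k y) atTop := lintegral_liminf_le hg
      _ ≤ liminf (fun _ : ℕ ↦ K * (μH[d + 1] s + 1)) atTop :=
        liminf_le_liminf (Eventually.of_forall integral_le)
      _ = K * (μH[d + 1] s + 1) := liminf_const _
      _ < ⊤ := ENNReal.mul_lt_top ENNReal.coe_lt_top (ENNReal.add_lt_top.2 ⟨hs, ENNReal.one_lt_top⟩)
  filter_upwards [ae_lt_top (Measurable.liminf hg) integral_liminf_lt_top.ne] with y hy
  refine lt_of_le_of_lt ?_ hy
  have h := Measure.hausdorffMeasure_le_liminf_tsum (ι := fun k ↦ {i // y ∈ c k i}) d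
    (s ∩ f ⁻¹' {y}) (fun k : ℕ ↦ (k : ℝ≥0∞)⁻¹) ENNReal.tendsto_inv_nat_nhds_zero
    (fun k i ↦ t k i) (Eventually.of_forall fun k i ↦ ht k i)
    (Eventually.of_forall fun k x hx ↦ by
      obtain ⟨i, hi⟩ := mem_iUnion.1 (hst k hx.1)
      exact mem_iUnion.2 ⟨⟨i, subset_closure ⟨x, hi, hx.2⟩⟩, hi⟩)
  refine h.trans_eq (congrArg (liminf · atTop) (funext fun k ↦ ?_))
  exact tsum_subtype {i | y ∈ c k i} fun i ↦ ediam (t k i) ^ d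

/-- (A coarea consequence.) If `X` is a metric space with finite Hausdorff
`n`-measure (`n ≥ 1`) and `U ⊆ X` is open with `X \ U` nonempty, then for Lebesgue-almost
every `δ > 0` the level set `{x : dist(x, X \ U) = δ}` has finite Hausdorff
`(n−1)`-measure. -/
theorem stmt8 (n : ℕ) (hn : 1 ≤ n) (X : Type*) [MetricSpace X]
    [MeasurableSpace X] [BorelSpace X]
    (hX : μH[(n : ℝ)] (Set.univ : Set X) < ⊤)
    (U : Set X) (hU : IsOpen U) (hne : (Uᶜ).Nonempty) :
    ∀ᵐ δ ∂(volume : Measure ℝ), 0 < δ →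
      μH[(n : ℝ) - 1] {x : X | Metric.infDist x Uᶜ = δ} < ⊤ := by
  have hd : (0 : ℝ) ≤ n - 1 := sub_nonneg.2 (by exact_mod_cast hn)
  filter_upwards [(lipschitz_infDist_pt Uᶜ).ae_hausdorffMeasure_inter_preimage_singleton_lt_top hd
    (s := univ) (by rwa [sub_add_cancel])] with δ hδ _
  rwa [univ_inter] at hδ
end
end

section
/- For every integer n ≥ 1 and every integer k ≥ 1 there exists s > 0 with the following property: there do not exist families B_0, B_1, …, B_n of subsets of the cube [0,1]^{n+1} (with the Euclidean metric) such that the union of all members of B_0 ∪ … ∪ B_n covers [0,1]^{n+1}, every member of every B_i has diameter at most 2s, and each family B_i is (2s/(3k))-separated. -/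
open Set Metric
open scoped ENNReal

noncomputable section

/-- The unit cube `[0,1]^{n+1}` in Euclidean space. -/
def unitCube (n : ℕ) : Set (EuclideanSpace ℝ (Fin (n + 1))) :=
  {x | ∀ j, x j ∈ Set.Icc (0 : ℝ) 1}

/-- The (extended) distance between two sets: `dist(A, B) = inf {d(a, b) : a ∈ A, b ∈ B}`. -/
def setEDist {E : Type*} [PseudoEMetricSpace E] (A B : Set E) : ℝ≥0∞ :=
  ⨅ a ∈ A, ⨅ b ∈ B, edist a b

/-- The integer grid point `p`, moved one step in direction `i`. -/
def gridStep {ι : Type*} [DecidableEq ι] (p : ι → ℕ) (i : ι) : ι → ℕ :=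
  Function.update p i (p i + 1)

/-- The mod 2 cubical cup product of the coboundaries of the functions `ℓ i`, for `i` in the list,
evaluated on the unit cube with base point `p` spanned by the directions in `S`. -/
def cupCoboundary {ι : Type*} [DecidableEq ι] (ℓ : ι → (ι → ℕ) → ZMod 2) :
    List ι → Finset ι → (ι → ℕ) → ZMod 2
  | [], _, _ => 1
  | a :: L, S, p => ∑ i ∈ S, (ℓ a (gridStep p i) - ℓ a p) *
      cupCoboundary ℓ L (S.erase i) (gridStep p i)

/-- The grid points with coordinates `< N` in the directions of `S` which agree with `q` in the
other directions. -/
def gridBox {ι : Type*} [Fintype ι] [DecidableEq ι] (N : ℕ) (S : Finset ι) (q : ι → ℕ) :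
    Finset (ι → ℕ) :=
  Fintype.piFinset fun i => if i ∈ S then Finset.range N else {q i}

section Grid

variable {ι : Type*} [DecidableEq ι]

theorem gridStep_comm (p : ι → ℕ) (i j : ι) :
    gridStep (gridStep p i) j = gridStep (gridStep p j) i := by
  ext x
  by_cases h : i = j
  · rw [h]
  · simp only [gridStep, Function.update_apply]
    split_ifs <;> simp_all

/-- A symmetric function sums to zero mod 2 over the ordered pairs of distinct elements. -/
theorem sum_sum_erase_eq_zero (S : Finset ι) (F : ι → ι → ZMod 2) (hF : ∀ i j, F i j = F j i) :
    ∑ i ∈ S, ∑ j ∈ S.erase i, F i j = 0 := by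
  rw [Finset.sum_sigma']
  refine Finset.sum_involution (fun x _ => ⟨x.2, x.1⟩) ?_ ?_ ?_ ?_
  · rintro ⟨i, j⟩ _
    simp only
    rw [hF i j]
    exact CharTwo.add_self_eq_zero _
  · rintro ⟨i, j⟩ h _ he
    simp only [Finset.mem_sigma, Finset.mem_erase] at h
    simp only [Sigma.mk.injEq] at he
    exact h.2.1 he.1
  · rintro ⟨i, j⟩ h
    simp only [Finset.mem_sigma, Finset.mem_erase] at h ⊢
    exact ⟨h.2.2, fun e => h.2.1 e.symm, h.1⟩
  · rintro ⟨i, j⟩ _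
    rfl

theorem sum_sum_erase_comm (S : Finset ι) (F : ι → ι → ZMod 2) :
    ∑ i ∈ S, ∑ j ∈ S.erase i, F i j = ∑ i ∈ S, ∑ j ∈ S.erase i, F j i := by
  refine Finset.sum_comm' fun i j => ?_
  simp only [Finset.mem_erase]
  tauto

/-- The cup product of coboundaries is closed. -/
theorem sum_cupCoboundary_sub_eq_zero (ℓ : ι → (ι → ℕ) → ZMod 2) (L : List ι) (S : Finset ι)
    (p : ι → ℕ) :
    ∑ i ∈ S, (cupCoboundary ℓ L (S.erase i) (gridStep p i) -
      cupCoboundary ℓ L (S.erase i) p) = 0 := by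
  induction L generalizing S p with
  | nil => simp [cupCoboundary]
  | cons a L ih =>
    simp only [cupCoboundary, sub_mul, Finset.sum_sub_distrib]
    have top : ∑ i ∈ S, ∑ j ∈ S.erase i, ℓ a (gridStep (gridStep p i) j) *
        cupCoboundary ℓ L ((S.erase i).erase j) (gridStep (gridStep p i) j) = 0 :=
      sum_sum_erase_eq_zero S _ fun i j => by rw [gridStep_comm, Finset.erase_right_comm]
    have mid : ∑ i ∈ S, ∑ j ∈ S.erase i, ℓ a (gridStep p i) *
          cupCoboundary ℓ L ((S.erase i).erase j) (gridStep (gridStep p i) j) =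
        ∑ i ∈ S, ∑ j ∈ S.erase i, ℓ a (gridStep p j) *
          cupCoboundary ℓ L ((S.erase i).erase j) (gridStep p j) := by
      rw [sum_sum_erase_comm S fun i j => ℓ a (gridStep p j) *
          cupCoboundary ℓ L ((S.erase i).erase j) (gridStep p j)]
      refine Finset.sum_congr rfl fun i _ => ?_
      have h := ih (S.erase i) (gridStep p i)
      rw [Finset.sum_sub_distrib, sub_eq_zero] at h
      rw [← Finset.mul_sum, h, Finset.mul_sum]
      exact Finset.sum_congr rfl fun j _ => by rw [Finset.erase_right_comm]
    have bot : ∑ i ∈ S, ∑ j ∈ S.erase i, ℓ a p *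
        cupCoboundary ℓ L ((S.erase i).erase j) (gridStep p j) = 0 := by
      have h : ∀ i, ∑ j ∈ S.erase i, ℓ a p *
            cupCoboundary ℓ L ((S.erase i).erase j) (gridStep p j) =
          ∑ j ∈ S.erase i, ℓ a p * cupCoboundary ℓ L ((S.erase i).erase j) p := fun i => by
        have h := ih (S.erase i) p
        rw [Finset.sum_sub_distrib, sub_eq_zero] at h
        rw [← Finset.mul_sum, h, Finset.mul_sum]
      rw [Finset.sum_congr rfl fun i _ => h i]
      exact sum_sum_erase_eq_zero S _ fun i j => by rw [Finset.erase_right_comm]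
    rw [top, mid, bot, zero_sub, sub_zero, CharTwo.neg_eq, sub_self]

/-- The cup product vanishes on cubes on which one of its functions is constant. -/
theorem cupCoboundary_eq_zero (ℓ : ι → (ι → ℕ) → ZMod 2) (i : ι) (m : ℕ) (c : ZMod 2)
    (hc : ∀ p : ι → ℕ, p i = m → ℓ i p = c) (L : List ι) (hi : i ∈ L) (S : Finset ι)
    (hS : i ∉ S) (p : ι → ℕ) (hp : p i = m) : cupCoboundary ℓ L S p = 0 := by
  induction L generalizing S p with
  | nil => simp at hi
  | cons a L ih =>
    refine Finset.sum_eq_zero fun j hj => ?_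
    have hij : i ≠ j := fun e => hS (e ▸ hj)
    have hpj : gridStep p j i = m := by simp [gridStep, hij, hp]
    rcases List.mem_cons.1 hi with rfl | hi
    · rw [hc _ hp, hc _ hpj]
      ring
    · rw [ih hi _ (fun h => hS (Finset.mem_of_mem_erase h)) _ hpj, mul_zero]

/-- If the cup product is nonzero on a cube, every function takes two values on that cube. -/
theorem exists_ne_of_cupCoboundary_ne_zero (ℓ : ι → (ι → ℕ) → ZMod 2) (L : List ι)
    (S : Finset ι) (p : ι → ℕ) (h : cupCoboundary ℓ L S p ≠ 0) (i : ι) (hi : i ∈ L) :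
    ∃ u v : ι → ℕ, (∀ j, p j ≤ u j ∧ u j ≤ p j + if j ∈ S then 1 else 0) ∧
      (∀ j, p j ≤ v j ∧ v j ≤ p j + if j ∈ S then 1 else 0) ∧ ℓ i u ≠ ℓ i v := by
  induction L generalizing S p with
  | nil => simp at hi
  | cons a L ih =>
    obtain ⟨k, hk, hne⟩ := Finset.exists_ne_zero_of_sum_ne_zero h
    have step : ∀ u : ι → ℕ, (∀ j, gridStep p k j ≤ u j ∧
        u j ≤ gridStep p k j + if j ∈ S.erase k then 1 else 0) →
        ∀ j, p j ≤ u j ∧ u j ≤ p j + if j ∈ S then 1 else 0 := by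
      intro u hu j
      have := hu j
      by_cases hjk : j = k
      · subst hjk
        simp [gridStep] at this
        simp only [hk, if_true]
        omega
      · simpa [gridStep, hjk] using this
    rcases List.mem_cons.1 hi with rfl | hi
    · refine ⟨gridStep p k, p, step _ fun j => ⟨le_rfl, Nat.le_add_right _ _⟩,
        fun j => ⟨le_rfl, Nat.le_add_right _ _⟩, sub_ne_zero.1 (left_ne_zero_of_mul hne)⟩
    · obtain ⟨u, v, hu, hv, huv⟩ := ih _ _ (right_ne_zero_of_mul hne) hi
      exact ⟨u, v, step u hu, step v hv, huv⟩

variable [Fintype ι]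

theorem mem_gridBox {N : ℕ} {S : Finset ι} {q p : ι → ℕ} :
    p ∈ gridBox N S q ↔ ∀ i, if i ∈ S then p i < N else p i = q i := by
  simp only [gridBox, Fintype.mem_piFinset]
  refine forall_congr' fun i => ?_
  split_ifs <;> simp

/-- Discrete fundamental theorem of calculus in one direction of a box. -/
theorem sum_gridBox_gridStep_sub (N : ℕ) (S : Finset ι) (q : ι → ℕ) (i : ι) (hi : i ∈ S)
    (h : (ι → ℕ) → ZMod 2) :
    ∑ p ∈ gridBox N S q, (h (gridStep p i) - h p) =
      ∑ p ∈ gridBox N (S.erase i) (Function.update q i N), h p -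
        ∑ p ∈ gridBox N (S.erase i) (Function.update q i 0), h p := by
  have slice : ∀ t ∈ Finset.range N, (gridBox N S q).filter (fun p => p i = t) =
      gridBox N (S.erase i) (Function.update q i t) := by
    intro t ht
    rw [Finset.mem_range] at ht
    ext p
    simp only [Finset.mem_filter, mem_gridBox, Finset.mem_erase]
    constructor
    · rintro ⟨hp, rfl⟩ j
      by_cases hj : j = i
      · subst hj; simp
      · simpa [hj] using hp j
    · intro hp
      have hpi : p i = t := by simpa using hp i
      refine ⟨fun j => ?_, hpi⟩
      by_cases hj : j = i
      · subst hj; simp [hi, hpi, ht]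
      · simpa [hj] using hp j
  have shift : ∀ t, ∑ p ∈ gridBox N (S.erase i) (Function.update q i t), h (gridStep p i) =
      ∑ p ∈ gridBox N (S.erase i) (Function.update q i (t + 1)), h p := by
    intro t
    refine Finset.sum_nbij' (fun p => gridStep p i) (fun p => Function.update p i t) ?_ ?_ ?_ ?_ ?_
    · intro p hp
      rw [mem_gridBox] at hp ⊢
      intro j
      have := hp j
      by_cases hj : j = i
      · subst hj; simp_all [gridStep]
      · simpa [hj, gridStep] using this
    · intro p hp
      rw [mem_gridBox] at hp ⊢
      intro j
      have := hp j
      by_cases hj : j = i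
      · subst hj; simp
      · simpa [hj] using this
    · intro p hp
      have : p i = t := by simpa using mem_gridBox.1 hp i
      simp [gridStep, ← this]
    · intro p hp
      have : p i = t + 1 := by simpa using mem_gridBox.1 hp i
      simp [gridStep, ← this]
    · exact fun _ _ => rfl
  have maps : ∀ p ∈ gridBox N S q, p i ∈ Finset.range N := fun p hp => by
    simpa [hi] using mem_gridBox.1 hp i
  rw [← Finset.sum_fiberwise_of_maps_to maps,
    ← Finset.sum_range_sub fun t => ∑ p ∈ gridBox N (S.erase i) (Function.update q i t), h p]
  refine Finset.sum_congr rfl fun t ht => ?_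
  rw [slice t ht, Finset.sum_sub_distrib, shift]

theorem sum_gridBox_cupCoboundary (ℓ : ι → (ι → ℕ) → ZMod 2) (N : ℕ)
    (h0 : ∀ i p, p i = 0 → ℓ i p = 0) (h1 : ∀ i p, p i = N → ℓ i p = 1) (L : List ι)
    (hL : L.Nodup) (q : ι → ℕ) :
    ∑ p ∈ gridBox N L.toFinset q, cupCoboundary ℓ L L.toFinset p = 1 := by
  induction L generalizing q with
  | nil =>
    have : gridBox N ([] : List ι).toFinset q = {q} := by
      ext p
      simp [mem_gridBox, funext_iff]
    rw [this]
    simp [cupCoboundary]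
  | cons a L ih =>
    obtain ⟨ha, hL⟩ := List.nodup_cons.1 hL
    set S := (a :: L).toFinset with hS
    have haS : a ∈ S := by simp [hS]
    have erase_a : S.erase a = L.toFinset := by
      rw [hS, List.toFinset_cons, Finset.erase_insert (by simpa using ha)]
    have exact_form : ∀ p, cupCoboundary ℓ (a :: L) S p =
        ∑ i ∈ S, (ℓ a (gridStep p i) * cupCoboundary ℓ L (S.erase i) (gridStep p i) -
          ℓ a p * cupCoboundary ℓ L (S.erase i) p) := by
      intro p
      have h := congrArg (ℓ a p * ·) (sum_cupCoboundary_sub_eq_zero ℓ L S p)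
      simp only [mul_zero, Finset.mul_sum] at h
      rw [cupCoboundary, ← sub_eq_zero, ← Finset.sum_sub_distrib, ← neg_eq_zero, ← h,
        ← Finset.sum_neg_distrib]
      exact Finset.sum_congr rfl fun i _ => by ring
    rw [Finset.sum_congr rfl fun p _ => exact_form p, Finset.sum_comm,
      Finset.sum_congr rfl fun i hi => sum_gridBox_gridStep_sub N S q i hi fun p =>
        ℓ a p * cupCoboundary ℓ L (S.erase i) p]
    have value : ∀ i t, ∀ p ∈ gridBox N (S.erase i) (Function.update q i t), p i = t :=
      fun i t p hp => by simpa using mem_gridBox.1 hp i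
    rw [Finset.sum_eq_single_of_mem a haS]
    · rw [Finset.sum_congr rfl fun p hp => by rw [h1 a p (value a N p hp), one_mul],
        Finset.sum_eq_zero (s := gridBox N (S.erase a) (Function.update q a 0))
          fun p hp => by rw [h0 a p (value a 0 p hp), zero_mul],
        sub_zero, erase_a]
      exact ih hL _
    · intro i hi hia
      have hiL : i ∈ L := by simpa [hS, hia] using hi
      rw [Finset.sum_eq_zero fun p hp => by
          rw [cupCoboundary_eq_zero ℓ i N 1 (h1 i) L hiL _ (Finset.notMem_erase _ _) p
            (value i N p hp), mul_zero],
        Finset.sum_eq_zero fun p hp => by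
          rw [cupCoboundary_eq_zero ℓ i 0 0 (h0 i) L hiL _ (Finset.notMem_erase _ _) p
            (value i 0 p hp), mul_zero], sub_zero]

/-- Discrete Poincaré–Miranda theorem: if `ℓ i` is `0` on the face `p i = 0` and `1` on the face
`p i = N`, then on some unit cell of the grid every `ℓ i` takes both values. -/
theorem exists_cell_forall_ne (ℓ : ι → (ι → ℕ) → ZMod 2) (N : ℕ)
    (h0 : ∀ i p, p i = 0 → ℓ i p = 0) (h1 : ∀ i p, p i = N → ℓ i p = 1) :
    ∃ p : ι → ℕ, (∀ i, p i < N) ∧ ∀ i, ∃ u v : ι → ℕ, (∀ j, p j ≤ u j ∧ u j ≤ p j + 1) ∧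
      (∀ j, p j ≤ v j ∧ v j ≤ p j + 1) ∧ ℓ i u = 0 ∧ ℓ i v = 1 := by
  have h := sum_gridBox_cupCoboundary ℓ N h0 h1 _ (Finset.nodup_toList Finset.univ) 0
  rw [Finset.toList_toFinset] at h
  obtain ⟨p, hp, hne⟩ := Finset.exists_ne_zero_of_sum_ne_zero (h.trans_ne one_ne_zero)
  refine ⟨p, fun i => by simpa using mem_gridBox.1 hp i, fun i => ?_⟩
  obtain ⟨u, v, hu, hv, huv⟩ := exists_ne_of_cupCoboundary_ne_zero ℓ _ _ p hne i (by simp)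
  simp only [Finset.mem_univ, if_true] at hu hv
  have two : ∀ a b : ZMod 2, a ≠ b → a = 0 ∧ b = 1 ∨ b = 0 ∧ a = 1 := by decide
  rcases two _ _ huv with ⟨e, e'⟩ | ⟨e, e'⟩
  · exact ⟨u, v, hu, hv, e, e'⟩
  · exact ⟨v, u, hv, hu, e, e'⟩

end Grid

/-- Lebesgue's covering theorem, for `n + 1` pairs of sets: if, for each direction `i`, the
sets `A i ⊇ {x i = 0}` and `C i ⊇ {x i = 1}` are at distance at least `t > 0`, then some
point of the unit cube lies in no `A i` and no `C i`. -/
theorem exists_mem_unitCube_forall_notMem (n : ℕ) (t : ℝ) (ht : 0 < t)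
    (A C : Fin (n + 1) → Set (EuclideanSpace ℝ (Fin (n + 1))))
    (hA : ∀ i x, x i = 0 → x ∈ A i) (hC : ∀ i x, x i = 1 → x ∈ C i)
    (hAC : ∀ i, ∀ a ∈ A i, ∀ c ∈ C i, t ≤ dist a c) :
    ∃ x ∈ unitCube n, ∀ i, x ∉ A i ∧ x ∉ C i := by
  classical
  obtain ⟨N, hN⟩ := exists_nat_gt ((n + 1) / (t / 2))
  have hN0 : (0 : ℝ) < N := lt_of_le_of_lt (by positivity) hN
  have hmesh : ((n : ℝ) + 1) / N < t / 2 := by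
    rw [div_lt_iff₀ (by positivity)] at hN ⊢
    linarith
  let pt : (Fin (n + 1) → ℕ) → EuclideanSpace ℝ (Fin (n + 1)) :=
    fun p => WithLp.toLp 2 fun j => (p j : ℝ) / N
  have pt_apply : ∀ p j, pt p j = (p j : ℝ) / N := fun _ _ => rfl
  have near : ∀ p u : Fin (n + 1) → ℕ, (∀ j, p j ≤ u j ∧ u j ≤ p j + 1) →
      dist (pt u) (pt p) < t / 2 := by
    intro p u hu
    refine lt_of_le_of_lt ?_ hmesh
    rw [EuclideanSpace.dist_eq]
    refine Real.sqrt_le_iff.2 ⟨by positivity, ?_⟩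
    have hcoord : ∀ j ∈ Finset.univ, dist (pt u j) (pt p j) ^ 2 ≤ (1 / (N : ℝ)) ^ 2 := by
      intro j _
      have h1 : (p j : ℝ) ≤ u j := by exact_mod_cast (hu j).1
      have h2 : (u j : ℝ) ≤ p j + 1 := by exact_mod_cast (hu j).2
      refine pow_le_pow_left₀ dist_nonneg ?_ 2
      rw [pt_apply, pt_apply, Real.dist_eq, ← sub_div, abs_of_nonneg (by
        apply div_nonneg <;> linarith)]
      gcongr
      linarith
    refine (Finset.sum_le_sum hcoord).trans ?_
    rw [Finset.sum_const, Finset.card_univ, Fintype.card_fin, nsmul_eq_mul, div_pow, div_pow,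
      ← mul_div_assoc]
    gcongr
    push_cast
    nlinarith [(Nat.cast_nonneg n : (0 : ℝ) ≤ n)]
  let ℓ : Fin (n + 1) → (Fin (n + 1) → ℕ) → ZMod 2 :=
    fun i p => if ∃ a ∈ A i, dist (pt p) a < t / 2 then 0 else 1
  obtain ⟨p, hp, hcell⟩ := exists_cell_forall_ne ℓ N
    (fun i p hpi => if_pos ⟨pt p, hA i _ (by simp [pt_apply, hpi]), by simpa using ht⟩)
    (fun i p hpi => if_neg (by
      rintro ⟨a, ha, hd⟩
      have := hAC i a ha (pt p) (hC i _ (by rw [pt_apply, hpi, div_self hN0.ne']))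
      rw [dist_comm] at this
      linarith))
  refine ⟨pt p, fun j => ⟨by rw [pt_apply]; positivity, ?_⟩, fun i => ?_⟩
  · rw [pt_apply, div_le_one hN0]
    exact_mod_cast (hp j).le
  obtain ⟨u, v, hu, hv, hℓu, hℓv⟩ := hcell i
  have hu' : ∃ a ∈ A i, dist (pt u) a < t / 2 := by
    by_contra hcon
    exact absurd ((if_neg hcon).symm.trans hℓu) one_ne_zero
  have hv' : ¬ ∃ a ∈ A i, dist (pt v) a < t / 2 := fun hcon =>
    absurd ((if_pos hcon).symm.trans hℓv) zero_ne_one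
  refine ⟨fun h => hv' ⟨_, h, near p v hv⟩, fun h => ?_⟩
  obtain ⟨a, ha, hd⟩ := hu'
  have := hAC i a ha _ h
  have := dist_triangle a (pt u) (pt p)
  rw [dist_comm a (pt u)] at this
  linarith [near p u hu]

theorem abs_apply_sub_apply_le_dist {ι : Type*} [Fintype ι] (x y : EuclideanSpace ℝ ι) (i : ι) :
    |x i - y i| ≤ dist x y := by
  rw [dist_eq_norm]
  exact PiLp.norm_apply_le (x - y) i

/-- For every `n ≥ 1` and `k ≥ 1` there is `s > 0` such that the cube
`[0,1]^{n+1}` (with the Euclidean metric) admits no cover by families `B_0, …, B_n` of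
subsets, each member of diameter at most `2s`, with each family `B_i`
`(2s/(3k))`-separated. -/
theorem stmt10 (n k : ℕ) (hn : 1 ≤ n) (hk : 1 ≤ k) :
    ∃ s : ℝ, 0 < s ∧
      ¬ ∃ B : Fin (n + 1) → Set (Set (EuclideanSpace ℝ (Fin (n + 1)))),
          -- the members are subsets of the cube
          (∀ i, ∀ A ∈ B i, A ⊆ unitCube n) ∧
          -- the union of all members covers the cube
          (∀ x ∈ unitCube n, ∃ i, ∃ A ∈ B i, x ∈ A) ∧
          -- each member has diameter at most `2s`
          (∀ i, ∀ A ∈ B i, EMetric.diam A ≤ ENNReal.ofReal (2 * s)) ∧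
          -- each family `B i` is `(2s/(3k))`-separated
          (∀ i, ∀ A ∈ B i, ∀ A' ∈ B i, A ≠ A' →
            ENNReal.ofReal (2 * s / (3 * k)) < setEDist A A') := by
  have hk' : (1 : ℝ) ≤ k := by exact_mod_cast hk
  refine ⟨1 / 4, by norm_num, ?_⟩
  rintro ⟨B, -, hcov, hdiam, hsep⟩
  set t : ℝ := 2 * (1 / 4) / (3 * k) with ht_def
  have ht : 0 < t := by positivity
  have ht' : t ≤ 1 / 6 := by
    rw [ht_def, div_le_iff₀ (by positivity)]
    linarith
  have hdist : ∀ i, ∀ M ∈ B i, ∀ x ∈ M, ∀ y ∈ M, dist x y ≤ 1 / 2 := by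
    intro i M hM x hx y hy
    have := (Metric.edist_le_ediam_of_mem hx hy).trans (hdiam i M hM)
    rw [edist_dist, ENNReal.ofReal_le_ofReal_iff (by norm_num)] at this
    linarith
  have hgap : ∀ i, ∀ M ∈ B i, ∀ M' ∈ B i, M ≠ M' → ∀ x ∈ M, ∀ y ∈ M', t < dist x y := by
    intro i M hM M' hM' hne x hx y hy
    have := (hsep i M hM M' hM' hne).trans_le ((iInf₂_le x hx).trans (iInf₂_le y hy))
    rw [edist_dist] at this
    exact (ENNReal.ofReal_lt_ofReal_iff_of_nonneg ht.le).1 this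
  obtain ⟨x, hx, hout⟩ := exists_mem_unitCube_forall_notMem n t ht
    (fun i => {x | x i = 0 ∨ ∃ M ∈ B i, x ∈ M ∧ ∃ y ∈ M, y i ≤ t})
    (fun i => {x | x i = 1 ∨ ∃ M ∈ B i, x ∈ M ∧ ∀ y ∈ M, t < y i})
    (fun _ _ h => Or.inl h) (fun _ _ h => Or.inl h) (by
      rintro i a ha c hc
      have hac := abs_apply_sub_apply_le_dist a c i
      rw [abs_le] at hac
      rcases ha with ha | ⟨M, hM, haM, y, hy, hyt⟩ <;> rcases hc with hc | ⟨M', hM', hcM, hfar⟩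
      · linarith
      · linarith [hfar c hcM]
      · have hay := (abs_le.1 (abs_apply_sub_apply_le_dist a y i)).2
        linarith [hdist i M hM a haM y hy]
      · refine (hgap i M hM M' hM' ?_ a haM c hcM).le
        rintro rfl
        exact absurd (hfar y hy) hyt.not_gt)
  obtain ⟨i, M, hM, hxM⟩ := hcov x hx
  by_cases hnear : ∃ y ∈ M, y i ≤ t
  · exact (hout i).1 (Or.inr ⟨M, hM, hxM, hnear⟩)
  · push Not at hnear
    exact (hout i).2 (Or.inr ⟨M, hM, hxM, hnear⟩)
end
end
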